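/- There exists a nonempty set A ⊆ V_↓ such that sSup { gimp a (sInf A) | a ∈ A } = 0; in particular this supremum is strictly less than 1. (This expresses that the formula C_↑ = ∃x(A(x) → ∀y A(y)) is not valid in the Gödel logic G_↓.) -/

import Mathlib

/-- The Gödel implication. -/
noncomputable def gimp (a b : ℝ) : ℝ := if a ≤ b then 1 else b

/-- The truth value set `V_↓ = {1/k : k ≥ 1} ∪ {0}` of the Gödel logic `G_↓`. -/
def Vdn : Set ℝ := {x | ∃ k : ℕ, 1 ≤ k ∧ x = 1 / (k : ℝ)} ∪ {0}

theorem Cup_not_valid_in_Gdn :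
    ∃ A : Set ℝ, A ⊆ Vdn ∧ A.Nonempty ∧
      sSup ((fun a => gimp a (sInf A)) '' A) = 0 ∧
      sSup ((fun a => gimp a (sInf A)) '' A) < 1 := by
  let A : Set ℝ := {x | ∃ k : ℕ, 1 ≤ k ∧ x = 1 / (k : ℝ)}
  have hpos : ∀ a ∈ A, 0 < a := by
    rintro a ⟨k, hk, rfl⟩
    have : (0 : ℝ) < k := by exact_mod_cast hk
    positivity
  have hne : A.Nonempty := ⟨1, 1, le_refl _, by norm_num⟩
  have hinf : sInf A = 0 := by
    apply le_antisymm
    · apply le_of_forall_pos_le_add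
      intro e he
      obtain ⟨n, hn⟩ := exists_nat_one_div_lt he
      have hb : BddBelow A := ⟨0, fun a ha => (hpos a ha).le⟩
      have h := csInf_le hb (show (1 / ((n : ℝ) + 1)) ∈ A from
        ⟨n + 1, by omega, by push_cast; rfl⟩)
      linarith
    · exact le_csInf hne fun a ha => (hpos a ha).le
  have himg : (fun a => gimp a (sInf A)) '' A = {0} := by
    rw [hinf]
    have hg : ∀ a ∈ A, gimp a 0 = 0 := fun a ha => by
      simp [gimp, not_le.mpr (hpos a ha)]
    ext y
    constructor
    · rintro ⟨a, ha, rfl⟩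
      exact hg a ha
    · rintro rfl
      obtain ⟨a, ha⟩ := hne
      exact ⟨a, ha, hg a ha⟩
  refine ⟨A, fun x hx => Or.inl hx, hne, ?_, ?_⟩
  · rw [himg, csSup_singleton]
  · rw [himg, csSup_singleton]
    exact one_pos
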